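/- arXiv:1602.03990 — 2 statements merged into one kernel-verified Lean document; each statement's English description precedes it below -/
import Mathlib

section
/- Theorem 2 (hidden-state part, one-way fANOVA): the posterior of the pair of hidden states (S,R) is a Markov tree on the product state space {0,1}×{0,1} with initial probabilities ρ₀₀(s)κ₀₀(r)φ₀₀(s,r)/ξ₀₀(0,0) and transition probabilities ρ_{j,k}(s,s')κ_{j,k}(r,r')φ_{j,k}(s',r')/ξ_{j,k}(s,r). Precisely, assume ξ_{j,k}(s,r) ≠ 0 for all (j,k) ∈ T with j ≥ 1 and all (s,r), and ξ₀₀(0,0) ≠ 0. Then for every pair of assignments S, R : T → {0,1}: [ρ₀₀(S(0,0))κ₀₀(R(0,0))·φ₀₀(S(0,0),R(0,0))/ξ₀₀(0,0)] · ∏_{j=1}^{J} ∏_{k} [ρ_{j,k}(S_p, S(j,k))·κ_{j,k}(R_p, R(j,k))·φ_{j,k}(S(j,k),R(j,k))/ξ_{j,k}(S_p, R_p)] = P(S,R)·L(S,R)/ξ₀₀(0,0), where S_p = S(j−1,⌊k/2⌋), R_p = R(j−1,⌊k/2⌋), P(S,R) = ρ₀₀(S(0,0))κ₀₀(R(0,0))·∏_{j=1}^{J}∏_{k}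 ρ_{j,k}(S_p,S(j,k))κ_{j,k}(R_p,R(j,k)), and L(S,R) = ∏_{(j,k)∈T} m_{j,k}(S(j,k),R(j,k)). -/
open scoped BigOperators

/-- If `m < 2^(t+1)` then `m / 2 < 2^t`. -/
lemma half_lt {t m : ℕ} (hm : m < 2 ^ (t + 1)) : m / 2 < 2 ^ t :=
  Nat.div_lt_of_lt_mul (by rw [mul_comm]; simpa [pow_succ] using hm)

/-- The bottom-up pyramid recursion `φ_{j,k}(s,r)` for the pair of hidden states `(S,R)` of the
one-way fANOVA model: `φ_{J,k}(s,r) = m_{J,k}(s,r)`, and for `j < J`,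
`φ_{j,k}(s,r) = m_{j,k}(s,r)·ξ_{j+1,2k}(s,r)·ξ_{j+1,2k+1}(s,r)` where
`ξ_{j,k}(s,r) = ∑_{s',r'} ρ_{j,k}(s,s')κ_{j,k}(r,r')·φ_{j,k}(s',r')`. -/
noncomputable def phi2 (J : ℕ) (ρ κ : ℕ → ℕ → Bool → Bool → ℝ)
    (m : ℕ → ℕ → Bool → Bool → ℝ) : ℕ → ℕ → Bool → Bool → ℝ
  | j, k, s, r =>
    if h : j < J then
      m j k s r
        * (∑ s' : Bool, ∑ r' : Bool,
            ρ (j + 1) (2 * k) s s' * κ (j + 1) (2 * k) r r'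
              * phi2 J ρ κ m (j + 1) (2 * k) s' r')
        * (∑ s' : Bool, ∑ r' : Bool,
            ρ (j + 1) (2 * k + 1) s s' * κ (j + 1) (2 * k + 1) r r'
              * phi2 J ρ κ m (j + 1) (2 * k + 1) s' r')
    else m j k s r
  termination_by j _ _ _ => J - j
  decreasing_by all_goals omega

/-- `ξ_{j,k}(s,r) = ∑_{s',r'} ρ_{j,k}(s,s')κ_{j,k}(r,r')·φ_{j,k}(s',r')`, for `j ≥ 1`. -/
noncomputable def xi2 (J : ℕ) (ρ κ : ℕ → ℕ → Bool → Bool → ℝ)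
    (m : ℕ → ℕ → Bool → Bool → ℝ) (j k : ℕ) (s r : Bool) : ℝ :=
  ∑ s' : Bool, ∑ r' : Bool, ρ j k s s' * κ j k r r' * phi2 J ρ κ m j k s' r'

/-- `ξ₀₀(0,0) = ∑_{s',r'} ρ₀₀(s')κ₀₀(r')·φ₀₀(s',r')` (independent of its arguments). -/
noncomputable def xiRoot2 (J : ℕ) (ρ₀ κ₀ : Bool → ℝ) (ρ κ : ℕ → ℕ → Bool → Bool → ℝ)
    (m : ℕ → ℕ → Bool → Bool → ℝ) : ℝ :=
  ∑ s' : Bool, ∑ r' : Bool, ρ₀ s' * κ₀ r' * phi2 J ρ κ m 0 0 s' r'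

lemma prod_range_two_mul (g : ℕ → ℝ) (n : ℕ) :
    ∏ k ∈ Finset.range (2 * n), g k = ∏ k ∈ Finset.range n, g (2 * k) * g (2 * k + 1) := by
  induction n with
  | zero => simp
  | succ n ih =>
    rw [Nat.mul_succ, Finset.prod_range_succ, Finset.prod_range_succ, ih,
      Finset.prod_range_succ, mul_assoc]

lemma phi2_leaf (J : ℕ) (ρ κ m : ℕ → ℕ → Bool → Bool → ℝ) (k : ℕ) (s r : Bool) :
    phi2 J ρ κ m J k s r = m J k s r := by
  rw [phi2, dif_neg (lt_irrefl J)]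

lemma phi2_of_lt {J j : ℕ} (ρ κ m : ℕ → ℕ → Bool → Bool → ℝ) (k : ℕ) (s r : Bool) (h : j < J) :
    phi2 J ρ κ m j k s r =
      m j k s r * (xi2 J ρ κ m (j + 1) (2 * k) s r * xi2 J ρ κ m (j + 1) (2 * k + 1) s r) := by
  rw [phi2, dif_pos h, mul_assoc]
  rfl

/-- On a level above the leaves, the product of the `φ` is the product of the likelihoods on that
level times the product of the `ξ` on the next one. -/
lemma prod_phi2_level {J t : ℕ} (ρ κ m : ℕ → ℕ → Bool → Bool → ℝ) (s r : ℕ → ℕ → Bool)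
    (h : t < J) :
    ∏ k ∈ Finset.range (2 ^ t), phi2 J ρ κ m t k (s t k) (r t k) =
      (∏ k ∈ Finset.range (2 ^ t), m t k (s t k) (r t k)) *
        ∏ k ∈ Finset.range (2 ^ (t + 1)),
          xi2 J ρ κ m (t + 1) k (s t (k / 2)) (r t (k / 2)) := by
  rw [pow_succ', prod_range_two_mul, ← Finset.prod_mul_distrib]
  refine Finset.prod_congr rfl fun k _ => ?_
  have h₀ : 2 * k / 2 = k := by omega
  have h₁ : (2 * k + 1) / 2 = k := by omega
  rw [phi2_of_lt ρ κ m k _ _ h, h₀, h₁]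

/-- Multiplying the level products of `φ` over the whole tree gives the likelihood times the
product of all `ξ` below the root. -/
lemma prod_phi2_tree (J : ℕ) (ρ κ m : ℕ → ℕ → Bool → Bool → ℝ) (s r : ℕ → ℕ → Bool) :
    phi2 J ρ κ m 0 0 (s 0 0) (r 0 0) *
        ∏ t ∈ Finset.range J, ∏ k ∈ Finset.range (2 ^ (t + 1)),
          phi2 J ρ κ m (t + 1) k (s (t + 1) k) (r (t + 1) k) =
      (∏ t ∈ Finset.range (J + 1), ∏ k ∈ Finset.range (2 ^ t), m t k (s t k) (r t k)) *
        ∏ t ∈ Finset.range J, ∏ k ∈ Finset.range (2 ^ (t + 1)),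
          xi2 J ρ κ m (t + 1) k (s t (k / 2)) (r t (k / 2)) := by
  have hroot := Finset.prod_range_succ'
    (fun t => ∏ k ∈ Finset.range (2 ^ t), phi2 J ρ κ m t k (s t k) (r t k)) J
  simp only [pow_zero, Finset.prod_range_one] at hroot
  rw [mul_comm, ← hroot, Finset.prod_range_succ, Finset.prod_range_succ,
    Finset.prod_congr rfl fun t ht => prod_phi2_level ρ κ m s r (Finset.mem_range.mp ht),
    Finset.prod_mul_distrib]
  simp only [phi2_leaf]
  ring

lemma exists_eq_restrict (J : ℕ) (S : (t : Fin (J + 1)) → Fin (2 ^ (t : ℕ)) → Bool) :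
    ∃ s : ℕ → ℕ → Bool, S = fun (t : Fin (J + 1)) (k : Fin (2 ^ (t : ℕ))) => s t k := by
  refine ⟨fun t k => if h : t < J + 1 ∧ k < 2 ^ t then S ⟨t, h.1⟩ ⟨k, h.2⟩ else false, ?_⟩
  funext t k
  simp [t.isLt, k.isLt, -Order.lt_add_one_iff]

/-- Theorem 2, hidden-state part, one-way fANOVA: the posterior of the pair of
hidden states `(S,R)` is a Markov tree on the product state space `{0,1}×{0,1}` with initial
probabilities `ρ₀₀(s)κ₀₀(r)φ₀₀(s,r)/ξ₀₀(0,0)` and transition probabilities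
`ρ_{j,k}(s,s')κ_{j,k}(r,r')φ_{j,k}(s',r')/ξ_{j,k}(s,r)`: for all assignments `S, R` of the full
tree, the product of these posterior probabilities equals `P(S,R)·L(S,R)/ξ₀₀(0,0)`. -/
theorem stmt4 (J : ℕ) (ρ₀ κ₀ : Bool → ℝ) (ρ κ : ℕ → ℕ → Bool → Bool → ℝ)
    (m : ℕ → ℕ → Bool → Bool → ℝ)
    (hξ : ∀ j k, 1 ≤ j → j ≤ J → k < 2 ^ j → ∀ s r : Bool, xi2 J ρ κ m j k s r ≠ 0)
    (hξ0 : xiRoot2 J ρ₀ κ₀ ρ κ m ≠ 0)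
    (S R : (t : Fin (J + 1)) → Fin (2 ^ (t : ℕ)) → Bool) :
    (ρ₀ (S ⟨0, by omega⟩ ⟨0, by positivity⟩) * κ₀ (R ⟨0, by omega⟩ ⟨0, by positivity⟩)
          * phi2 J ρ κ m 0 0 (S ⟨0, by omega⟩ ⟨0, by positivity⟩)
              (R ⟨0, by omega⟩ ⟨0, by positivity⟩)
          / xiRoot2 J ρ₀ κ₀ ρ κ m)
        * ∏ t : Fin J, ∏ kk : Fin (2 ^ ((t : ℕ) + 1)),
            (ρ ((t : ℕ) + 1) (kk : ℕ)
                (S ⟨(t : ℕ), by have := t.isLt; omega⟩ ⟨(kk : ℕ) / 2, half_lt kk.isLt⟩)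
                (S ⟨(t : ℕ) + 1, by have := t.isLt; omega⟩ kk)
              * κ ((t : ℕ) + 1) (kk : ℕ)
                  (R ⟨(t : ℕ), by have := t.isLt; omega⟩ ⟨(kk : ℕ) / 2, half_lt kk.isLt⟩)
                  (R ⟨(t : ℕ) + 1, by have := t.isLt; omega⟩ kk)
              * phi2 J ρ κ m ((t : ℕ) + 1) (kk : ℕ)
                  (S ⟨(t : ℕ) + 1, by have := t.isLt; omega⟩ kk)
                  (R ⟨(t : ℕ) + 1, by have := t.isLt; omega⟩ kk)
              / xi2 J ρ κ m ((t : ℕ) + 1) (kk : ℕ)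
                  (S ⟨(t : ℕ), by have := t.isLt; omega⟩ ⟨(kk : ℕ) / 2, half_lt kk.isLt⟩)
                  (R ⟨(t : ℕ), by have := t.isLt; omega⟩ ⟨(kk : ℕ) / 2, half_lt kk.isLt⟩))
    = (ρ₀ (S ⟨0, by omega⟩ ⟨0, by positivity⟩) * κ₀ (R ⟨0, by omega⟩ ⟨0, by positivity⟩)
          * ∏ t : Fin J, ∏ kk : Fin (2 ^ ((t : ℕ) + 1)),
              ρ ((t : ℕ) + 1) (kk : ℕ)
                  (S ⟨(t : ℕ), by have := t.isLt; omega⟩ ⟨(kk : ℕ) / 2, half_lt kk.isLt⟩)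
                  (S ⟨(t : ℕ) + 1, by have := t.isLt; omega⟩ kk)
                * κ ((t : ℕ) + 1) (kk : ℕ)
                    (R ⟨(t : ℕ), by have := t.isLt; omega⟩ ⟨(kk : ℕ) / 2, half_lt kk.isLt⟩)
                    (R ⟨(t : ℕ) + 1, by have := t.isLt; omega⟩ kk))
        * (∏ t : Fin (J + 1), ∏ kk : Fin (2 ^ (t : ℕ)),
            m (t : ℕ) (kk : ℕ) (S t kk) (R t kk))
        / xiRoot2 J ρ₀ κ₀ ρ κ m := by
  obtain ⟨s, rfl⟩ := exists_eq_restrict J S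
  obtain ⟨r, rfl⟩ := exists_eq_restrict J R
  have hphi := prod_phi2_tree J ρ κ m s r
  simp only [← Fin.prod_univ_eq_prod_range] at hphi
  have hne : ∏ t : Fin J, ∏ k : Fin (2 ^ ((t : ℕ) + 1)),
      xi2 J ρ κ m ((t : ℕ) + 1) k (s t ((k : ℕ) / 2)) (r t ((k : ℕ) / 2)) ≠ 0 :=
    Finset.prod_ne_zero_iff.mpr fun t _ => Finset.prod_ne_zero_iff.mpr fun k _ =>
      hξ _ _ (Nat.succ_pos _) t.isLt k.isLt _ _
  simp only [Finset.prod_div_distrib, Finset.prod_mul_distrib]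
  rw [div_mul_div_comm, div_eq_div_iff (mul_ne_zero hξ0 hne) hξ0]
  linear_combination (ρ₀ (s 0 0) * κ₀ (r 0 0) *
    ((∏ t : Fin J, ∏ k : Fin (2 ^ ((t : ℕ) + 1)),
        ρ ((t : ℕ) + 1) k (s t ((k : ℕ) / 2)) (s ((t : ℕ) + 1) k)) *
      ∏ t : Fin J, ∏ k : Fin (2 ^ ((t : ℕ) + 1)),
        κ ((t : ℕ) + 1) k (r t ((k : ℕ) / 2)) (r ((t : ℕ) + 1) k)) *
    xiRoot2 J ρ₀ κ₀ ρ κ m) * hphi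
end

section
/- Corollary 2 (pyramid recursion for the posterior joint null probability): let π : {0,1}×{0,1} → ℝ satisfy Σ_{(s,r)} π(s,r) = 1 and for each (j,k) ∈ T with j ≥ 1 let A_{j,k} : ({0,1}×{0,1})² → ℝ satisfy Σ_{(s',r')} A_{j,k}((s,r),(s',r')) = 1 for every (s,r). Define the Markov tree measure P(σ) = π(σ(0,0)) · ∏_{j=1}^{J} ∏_{k} A_{j,k}(σ(j−1,⌊k/2⌋), σ(j,k)) on assignments σ : T → {0,1}×{0,1}. Assume J ≥ 1 and define φ̃_{j,k} : {0,1} → ℝ bottom-up by φ̃_{J,k}(s) = Σ_{s'∈{0,1}} A_{J,k}((s,0),(s',0)), φ̃_{j,k}(s) = Σ_{s'∈{0,1}} A_{j,k}((s,0),(s',0))·φ̃_{j+1,2k}(s')·φ̃_{j+1,2k+1}(s') for 1 ≤ j < J, and φ̃₀₀ = Σ_{s'∈{0,1}} π(s',0)·φ̃_{1,0}(s')·φ̃_{1,1}(s'). Then the joint null probability satisfies Σ_{σ : σ(j,k) ∈ {0,1}×{0} for all (j,k) ∈ T} P(σ) = φ̃₀₀. -/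
open scoped BigOperators

/-- The bottom-up recursion `φ̃_{j,k}(s)` of Corollary 2 (used for `1 ≤ j ≤ J`):
`φ̃_{J,k}(s) = ∑_{s'} A_{J,k}((s,0),(s',0))`, and for `j < J`,
`φ̃_{j,k}(s) = ∑_{s'} A_{j,k}((s,0),(s',0))·φ̃_{j+1,2k}(s')·φ̃_{j+1,2k+1}(s')`.
Here the second component `0` of a state is encoded as `false`. -/
noncomputable def phiTilde (J : ℕ) (A : ℕ → ℕ → Bool × Bool → Bool × Bool → ℝ) :
    ℕ → ℕ → Bool → ℝ
  | j, k, s =>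
    if h : j < J then
      ∑ s' : Bool, A j k (s, false) (s', false)
        * phiTilde J A (j + 1) (2 * k) s' * phiTilde J A (j + 1) (2 * k + 1) s'
    else ∑ s' : Bool, A j k (s, false) (s', false)
  termination_by j _ _ => J - j
  decreasing_by all_goals omega

/-- A product over `2 ^ (n + 1)` indices, grouped into pairs of siblings. -/
lemma prod_fin_two_pow_succ {M : Type*} [CommMonoid M] (n : ℕ) (f : Fin (2 ^ (n + 1)) → M) :
    ∏ k, f k = ∏ k : Fin (2 ^ n),
      f ⟨2 * (k : ℕ), by have := k.isLt; rw [pow_succ]; omega⟩ *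
      f ⟨2 * (k : ℕ) + 1, by have := k.isLt; rw [pow_succ]; omega⟩ := by
  have e := Fintype.prod_equiv (finProdFinEquiv (m := 2 ^ n) (n := 2))
    (fun x => f (finProdFinEquiv x)) f (fun _ => rfl)
  refine e.symm.trans ?_
  rw [Fintype.prod_prod_type]
  refine Finset.prod_congr rfl fun k _ => ?_
  rw [Fin.prod_univ_two]
  congr 2 <;> apply Fin.ext <;> simp [finProdFinEquiv, add_comm]

/-- Weight of a labelling of the first `n + 1` levels of the binary tree. -/
def treeWeight {α : Type*} (p : α → ℝ) (B : ℕ → ℕ → α → α → ℝ) (n : ℕ)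
    (σ : (t : Fin (n + 1)) → Fin (2 ^ (t : ℕ)) → α) : ℝ :=
  p (σ 0 (0 : Fin 1)) *
    ∏ t : Fin n, ∏ kk : Fin (2 ^ ((t : ℕ) + 1)),
      B ((t : ℕ) + 1) (kk : ℕ)
        (σ t.castSucc ⟨(kk : ℕ) / 2, half_lt kk.isLt⟩)
        (σ t.succ kk)

lemma treeWeight_snoc {α : Type*} (p : α → ℝ) (B : ℕ → ℕ → α → α → ℝ) (n : ℕ)
    (σ : (t : Fin (n + 1)) → Fin (2 ^ (t : ℕ)) → α) (τ : Fin (2 ^ (n + 1)) → α) :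
    treeWeight p B (n + 1)
        (Fin.snoc (α := fun t : Fin (n + 2) => Fin (2 ^ (t : ℕ)) → α) σ τ) =
      treeWeight p B n σ * ∏ k : Fin (2 ^ (n + 1)),
        B (n + 1) k (σ (Fin.last n) ⟨(k : ℕ) / 2, half_lt k.isLt⟩) (τ k) := by
  have hσ (i : ℕ) (hi : i < n + 1) :
      Fin.snoc (α := fun t : Fin (n + 2) => Fin (2 ^ (t : ℕ)) → α) σ τ
        ⟨i, Nat.lt_succ_of_lt hi⟩ = σ ⟨i, hi⟩ :=
    Fin.snoc_castSucc (α := fun t : Fin (n + 2) => Fin (2 ^ (t : ℕ)) → α) τ σ ⟨i, hi⟩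
  have hτ : Fin.snoc (α := fun t : Fin (n + 2) => Fin (2 ^ (t : ℕ)) → α) σ τ
      ⟨n + 1, Nat.lt_succ_self _⟩ = τ :=
    Fin.snoc_last (α := fun t : Fin (n + 2) => Fin (2 ^ (t : ℕ)) → α) τ σ
  unfold treeWeight
  rw [Fin.prod_univ_castSucc, mul_assoc]
  refine congrArg₂ (· * ·) (congrArg p (congrFun (hσ 0 (by omega)) _)) (congrArg₂ (· * ·) ?_ ?_)
  · refine Finset.prod_congr rfl fun t _ => Finset.prod_congr rfl fun k _ => ?_
    have ht := t.isLt
    exact congrArg₂ (B (t + 1) k) (congrFun (hσ t (by omega)) _)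
      (congrFun (hσ (t + 1) (by omega)) _)
  · refine Finset.prod_congr rfl fun k _ => ?_
    exact congrArg₂ (B (n + 1) k) (congrFun (hσ n (by omega)) _) (congrFun hτ _)

/-- Upward message passing: if `V` satisfies the recursion of the messages from the two children
up to depth `J`, then the labels below the root can be summed out. -/
lemma sum_treeWeight_mul_prod {α : Type*} [Fintype α] (p : α → ℝ) (B : ℕ → ℕ → α → α → ℝ)
    (J : ℕ) (V : ℕ → ℕ → α → ℝ)
    (hV : ∀ j k s, j < J → V j k s = (∑ x, B (j + 1) (2 * k) s x * V (j + 1) (2 * k) x) *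
      ∑ x, B (j + 1) (2 * k + 1) s x * V (j + 1) (2 * k + 1) x) (n : ℕ) (hn : n ≤ J) :
    ∑ σ : (t : Fin (n + 1)) → Fin (2 ^ (t : ℕ)) → α,
      treeWeight p B n σ * ∏ k : Fin (2 ^ n), V n k (σ (Fin.last n) k) =
    ∑ s, p s * V 0 0 s := by
  induction n with
  | zero =>
    let e₀ : ((t : Fin (0 + 1)) → Fin (2 ^ (t : ℕ)) → α) ≃ (Fin (2 ^ 0) → α) :=
      Equiv.piUnique (fun t : Fin 1 => Fin (2 ^ (t : ℕ)) → α)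
    let e₁ : (Fin (2 ^ 0) → α) ≃ α := Equiv.funUnique (Fin 1) α
    refine Fintype.sum_equiv (e₀.trans e₁) _ _ fun σ => ?_
    have h : ∏ k : Fin (2 ^ 0), V 0 k (σ (Fin.last 0) k) = V 0 0 (σ 0 (0 : Fin 1)) :=
      Fin.prod_univ_one (fun k : Fin 1 => V 0 k (σ (Fin.last 0) k))
    rw [h, treeWeight, Finset.univ_eq_empty, Finset.prod_empty, mul_one]
    rfl
  | succ n ih =>
    rw [← ih (by omega), ← (Fin.snocEquiv
      (fun t : Fin (n + 2) => Fin (2 ^ (t : ℕ)) → α)).sum_comp, Fintype.sum_prod_type_right]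
    refine Finset.sum_congr rfl fun σ _ => ?_
    have key (τ : Fin (2 ^ (n + 1)) → α) :
        treeWeight p B (n + 1)
          (Fin.snoc (α := fun t : Fin (n + 2) => Fin (2 ^ (t : ℕ)) → α) σ τ) *
          ∏ k : Fin (2 ^ (n + 1)), V (n + 1) k
            (Fin.snoc (α := fun t : Fin (n + 2) => Fin (2 ^ (t : ℕ)) → α) σ τ
              (Fin.last (n + 1)) k) =
        treeWeight p B n σ * ∏ k : Fin (2 ^ (n + 1)),
          (B (n + 1) k (σ (Fin.last n) ⟨(k : ℕ) / 2, half_lt k.isLt⟩) (τ k) *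
            V (n + 1) k (τ k)) := by
      rw [treeWeight_snoc, Fin.snoc_last, Finset.prod_mul_distrib, mul_assoc]
    refine (Finset.sum_congr rfl fun τ _ => key τ).trans ?_
    refine (Finset.mul_sum _ _ _).symm.trans ?_
    congr 1
    refine (Fintype.prod_sum (fun (k : Fin (2 ^ (n + 1))) (x : α) =>
      B (n + 1) k (σ (Fin.last n) ⟨(k : ℕ) / 2, half_lt k.isLt⟩) x *
        V (n + 1) k x)).symm.trans ?_
    rw [prod_fin_two_pow_succ]
    refine Finset.prod_congr rfl fun k _ => ?_
    have h₀ : 2 * (k : ℕ) / 2 = k := by omega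
    have h₁ : (2 * (k : ℕ) + 1) / 2 = k := by omega
    simp only [h₀, h₁]
    exact (hV n k _ (by omega)).symm

/-- Restricting the weights to the states with vanishing second component restricts the tree
weight to the joint null event. -/
lemma treeWeight_null (π : Bool × Bool → ℝ) (A : ℕ → ℕ → Bool × Bool → Bool × Bool → ℝ) (J : ℕ)
    (σ : (t : Fin (J + 1)) → Fin (2 ^ (t : ℕ)) → Bool × Bool) :
    treeWeight (fun s => if s.2 = false then π s else 0)
        (fun j k s x => if x.2 = false then A j k (s.1, false) x else 0) J σ =
      if ∀ (t : Fin (J + 1)) (kk : Fin (2 ^ (t : ℕ))), (σ t kk).2 = false then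
        treeWeight π A J σ else 0 := by
  unfold treeWeight
  by_cases h : ∀ (t : Fin (J + 1)) (kk : Fin (2 ^ (t : ℕ))), (σ t kk).2 = false
  · rw [if_pos h]
    refine congrArg₂ (· * ·) (if_pos (h _ _)) ?_
    refine Finset.prod_congr rfl fun t _ => Finset.prod_congr rfl fun k _ => ?_
    refine (if_pos (h _ _)).trans ?_
    congr 1
    exact Prod.ext rfl (h _ _).symm
  · rw [if_neg h]
    push Not at h
    obtain ⟨⟨t, ht⟩, k, hk⟩ := h
    cases t with
    | zero =>
      obtain rfl : k = (0 : Fin 1) := Subsingleton.elim (α := Fin 1) _ _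
      exact mul_eq_zero_of_left (if_neg hk) _
    | succ t =>
      refine mul_eq_zero_of_right _ (Finset.prod_eq_zero
        (Finset.mem_univ (⟨t, by omega⟩ : Fin J)) ?_)
      exact Finset.prod_eq_zero (Finset.mem_univ k) (if_neg hk)

/-- Corollary 2, pyramid recursion for the posterior joint null probability:
for a Markov tree on the state space `{0,1}×{0,1}` with initial weights `π` (summing to one)
and row-stochastic transition weights `A_{j,k}` (`1 ≤ j ≤ J`), with `J ≥ 1`, the probability of
the joint null event `{σ : the second component of σ(j,k) is 0 at every node}` equals
`φ̃₀₀ = ∑_{s'} π(s',0)·φ̃_{1,0}(s')·φ̃_{1,1}(s')`. -/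
theorem stmt7 (J : ℕ) (hJ : 1 ≤ J) (π : Bool × Bool → ℝ)
    (A : ℕ → ℕ → Bool × Bool → Bool × Bool → ℝ)
    (hπ : ∑ sr : Bool × Bool, π sr = 1)
    (hA : ∀ j k, 1 ≤ j → j ≤ J → k < 2 ^ j →
      ∀ sr : Bool × Bool, ∑ sr' : Bool × Bool, A j k sr sr' = 1) :
    (∑ σ : (t : Fin (J + 1)) → Fin (2 ^ (t : ℕ)) → Bool × Bool,
        if ∀ (t : Fin (J + 1)) (kk : Fin (2 ^ (t : ℕ))), (σ t kk).2 = false then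
          π (σ ⟨0, by omega⟩ ⟨0, by positivity⟩)
            * ∏ t : Fin J, ∏ kk : Fin (2 ^ ((t : ℕ) + 1)),
                A ((t : ℕ) + 1) (kk : ℕ)
                  (σ ⟨(t : ℕ), by have := t.isLt; omega⟩ ⟨(kk : ℕ) / 2, half_lt kk.isLt⟩)
                  (σ ⟨(t : ℕ) + 1, by have := t.isLt; omega⟩ kk)
        else 0)
    = ∑ s' : Bool, π (s', false) * phiTilde J A 1 0 s' * phiTilde J A 1 1 s' := by
  let V : ℕ → ℕ → Bool × Bool → ℝ := fun j k s =>
    if j < J then phiTilde J A (j + 1) (2 * k) s.1 * phiTilde J A (j + 1) (2 * k + 1) s.1 else 1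
  have hφ (j k : ℕ) (s : Bool × Bool) :
      ∑ x : Bool × Bool, (if x.2 = false then A j k (s.1, false) x else 0) * V j k x =
        phiTilde J A j k s.1 := by
    rw [phiTilde]
    by_cases hj : j < J <;> simp [V, hj, Fintype.sum_prod_type, mul_assoc]
  have hV := sum_treeWeight_mul_prod (fun s => if s.2 = false then π s else 0)
    (fun j k s x => if x.2 = false then A j k (s.1, false) x else 0) J V
    (fun j k s hj => by rw [hφ, hφ]; simp [V, hj]) J le_rfl
  have hVJ (k : ℕ) (s : Bool × Bool) : V J k s = 1 := if_neg (lt_irrefl J)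
  simp only [hVJ, Finset.prod_const_one, mul_one, treeWeight_null] at hV
  refine Eq.trans ?_ (hV.trans ?_)
  · rfl
  · have hJ' : 0 < J := hJ
    simp [V, hJ', Fintype.sum_prod_type, mul_assoc]
end
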